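/- arXiv:1510.08331 — 2 statements merged into one kernel-verified Lean document; each statement's English description precedes it below -/
import Mathlib

section
/- Let T be a Petri net of dimension d, define prop_T(I) = ⋃ {pos(v) : (u,v) ∈ T, pos(u) ⊆ I}, and define the sequence I₀ = ∅ and I_k = prop_T(I_{k-1}) for k ≥ 1. Then I_d = I₊(T), i.e., the Kleene iteration reaches the set of forward markable indices in at most d steps. -/
/-- A configuration of dimension `d` is a vector in `ℕ^d`. -/
abbrev Config (d : ℕ) := Fin d → ℕ

/-- A transition is a pair `(u, v)` of configurations. -/
abbrev Transition (d : ℕ) := Config d × Config d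

/-- `x →t y` iff there exists `z` with `x = u + z` and `y = v + z` where `t = (u, v)`. -/
def Step {d : ℕ} (t : Transition d) (x y : Config d) : Prop :=
  ∃ z : Config d, x = t.1 + z ∧ y = t.2 + z

/-- `x →w y` for a word `w = t₁…t_k` of transitions. -/
def Fire {d : ℕ} : List (Transition d) → Config d → Config d → Prop
  | [], x, y => x = y
  | t :: w, x, y => ∃ c, Step t x c ∧ Fire w c y

/-- `x →T* y`: reachability via a word over `T`. -/
def ReachStar {d : ℕ} (T : Finset (Transition d)) (x y : Config d) : Prop :=
  ∃ w : List (Transition d), (∀ t ∈ w, t ∈ T) ∧ Fire w x y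

/-- `x →T+ y`: reachability via a nonempty word over `T`. -/
def ReachPlus {d : ℕ} (T : Finset (Transition d)) (x y : Config d) : Prop :=
  ∃ w : List (Transition d), w ≠ [] ∧ (∀ t ∈ w, t ∈ T) ∧ Fire w x y

/-- A configuration `c` is cyclic for `T` if `c →T+ c`. -/
def Cyclic {d : ℕ} (T : Finset (Transition d)) (c : Config d) : Prop :=
  ReachPlus T c c

/-- `T` is structurally cyclic if every configuration is cyclic for `T`. -/
def StructurallyCyclic {d : ℕ} (T : Finset (Transition d)) : Prop :=
  ∀ c : Config d, Cyclic T c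

/-- `pos c` is the set of indices where `c` is positive. -/
def pos {d : ℕ} (c : Config d) : Set (Fin d) := {i | 0 < c i}

/-- `I₊(T)`: the forward markable indices. -/
def Iplus {d : ℕ} (T : Finset (Transition d)) : Set (Fin d) :=
  {i | ∃ c : Config d, ReachStar T 0 c ∧ i ∈ pos c}

/-- `I₋(T)`: the backward markable indices. -/
def Iminus {d : ℕ} (T : Finset (Transition d)) : Set (Fin d) :=
  {i | ∃ c : Config d, ReachStar T c 0 ∧ i ∈ pos c}

/-- `I(T) = I₊(T) ∩ I₋(T)`. -/
def Iboth {d : ℕ} (T : Finset (Transition d)) : Set (Fin d) :=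
  Iplus T ∩ Iminus T

/-- `M(T)`: the mutually fireable transitions of `T`. -/
def MSet {d : ℕ} (T : Finset (Transition d)) : Set (Transition d) :=
  {t | t ∈ T ∧ pos t.1 ∪ pos t.2 ⊆ Iboth T}

/-- `U(T)`: the ultimately cyclic transitions of `T`. -/
def USet {d : ℕ} (T : Finset (Transition d)) : Set (Transition d) :=
  {t | ∃ (w : List (Transition d)) (c : Config d),
        (∀ s ∈ w, s ∈ T) ∧ t ∈ w ∧ Fire w c c}

/-- `Λ(T)`: the transitions occurring in a nonempty word `w` with `0 →w 0`. -/
def LambdaSet {d : ℕ} (T : Finset (Transition d)) : Set (Transition d) :=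
  {t | ∃ w : List (Transition d),
        (∀ s ∈ w, s ∈ T) ∧ t ∈ w ∧ Fire w (0 : Config d) (0 : Config d)}

/-- The displacement `Δ(t) = v - u ∈ ℤ^d` of a transition `t = (u, v)`. -/
def Delta {d : ℕ} (t : Transition d) : Fin d → ℤ :=
  fun i => (t.2 i : ℤ) - (t.1 i : ℤ)

/-- The propagation map `prop_T`. -/
def propMap {d : ℕ} (T : Finset (Transition d)) (I : Set (Fin d)) : Set (Fin d) :=
  {i | ∃ t ∈ T, pos t.1 ⊆ I ∧ i ∈ pos t.2}

/-- A Petri net is lossy if it contains the transition `(e_i, 0)` for every index `i`. -/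
def Lossy {d : ℕ} (T : Finset (Transition d)) : Prop :=
  ∀ i : Fin d, ((Pi.single i 1 : Config d), (0 : Config d)) ∈ T

theorem fire_append {d : ℕ} (w w' : List (Transition d)) (x y z : Config d)
    (h : Fire w x y) (h' : Fire w' y z) : Fire (w ++ w') x z := by
  induction w generalizing x with
  | nil => cases h; exact h'
  | cons t w ih =>
    obtain ⟨c, hc, hw⟩ := h
    exact ⟨c, hc, ih c hw⟩

theorem fire_add {d : ℕ} (w : List (Transition d)) (x y z : Config d)
    (h : Fire w x y) : Fire w (x + z) (y + z) := by
  induction w generalizing x with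
  | nil => cases h; rfl
  | cons t w ih =>
    obtain ⟨c, ⟨e, h1, h2⟩, hw⟩ := h
    exact ⟨c + z, ⟨e + z, by rw [h1, add_assoc], by rw [h2, add_assoc]⟩, ih c hw⟩

theorem reach_trans {d : ℕ} {T : Finset (Transition d)} {x y z : Config d}
    (h : ReachStar T x y) (h' : ReachStar T y z) : ReachStar T x z := by
  obtain ⟨w, hw, hf⟩ := h
  obtain ⟨w', hw', hf'⟩ := h'
  refine ⟨w ++ w', ?_, fire_append _ _ _ _ _ hf hf'⟩
  intro t ht
  rcases List.mem_append.1 ht with h | h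
  · exact hw t h
  · exact hw' t h

/-- The configurations reachable from `0` form a submonoid. -/
def reachMonoid {d : ℕ} (T : Finset (Transition d)) : AddSubmonoid (Config d) where
  carrier := {c | ReachStar T 0 c}
  zero_mem' := ⟨[], by simp, rfl⟩
  add_mem' := by
    rintro a b ha ⟨w, hw, hf⟩
    refine reach_trans ha ⟨w, hw, ?_⟩
    have := fire_add w 0 b a hf
    rwa [zero_add, add_comm b a] at this

theorem prop_mono {d : ℕ} (T : Finset (Transition d)) : Monotone (propMap T) := by
  rintro I J h i ⟨t, ht, hp, hi⟩
  exact ⟨t, ht, hp.trans h, hi⟩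

theorem prop_Iplus {d : ℕ} (T : Finset (Transition d)) : propMap T (Iplus T) ⊆ Iplus T := by
  rintro i ⟨t, ht, hp, hi⟩
  have H : ∀ j : Fin d, ∃ c ∈ reachMonoid T, t.1 j ≤ c j := by
    intro j
    by_cases hj : 0 < t.1 j
    · obtain ⟨c, hc, hcj⟩ := hp hj
      refine ⟨t.1 j • c, (reachMonoid T).nsmul_mem hc _, ?_⟩
      have : 0 < c j := hcj
      simpa using Nat.le_mul_of_pos_right _ this
    · exact ⟨0, (reachMonoid T).zero_mem, by simpa using hj⟩
  choose c hc hle using H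
  have hs : ReachStar T 0 (∑ j, c j) := (reachMonoid T).sum_mem (fun j _ => hc j)
  have hge : t.1 ≤ ∑ j, c j := by
    intro j
    rw [Finset.sum_apply]
    exact (hle j).trans
      (Finset.single_le_sum (f := fun k => c k j) (fun _ _ => Nat.zero_le _) (Finset.mem_univ j))
  obtain ⟨z, hz⟩ := exists_add_of_le hge
  refine ⟨t.2 + z, reach_trans hs ⟨[t], by simpa using ht, t.2 + z, ⟨z, hz, rfl⟩, rfl⟩, ?_⟩
  have : 0 < t.2 i := hi
  show 0 < t.2 i + z i
  omega

theorem fire_pos {d : ℕ} (T : Finset (Transition d)) (J : Set (Fin d)) (hJ : propMap T J ⊆ J)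
    (w : List (Transition d)) (x y : Config d) (hw : ∀ t ∈ w, t ∈ T) (h : Fire w x y)
    (hx : pos x ⊆ J) : pos y ⊆ J := by
  induction w generalizing x with
  | nil => cases h; exact hx
  | cons t w ih =>
    obtain ⟨c, ⟨z, h1, h2⟩, hf⟩ := h
    refine ih c (fun s hs => hw s (List.mem_cons_of_mem _ hs)) hf ?_
    intro i hi
    have hi' : 0 < t.2 i + z i := by
      have : 0 < c i := hi
      rwa [h2] at this
    by_cases hz : 0 < z i
    · apply hx
      show 0 < x i
      rw [h1]
      show 0 < t.1 i + z i
      omega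
    · refine hJ ⟨t, hw t (by simp), ?_, ?_⟩
      · intro j hj
        apply hx
        have : 0 < t.1 j := hj
        show 0 < x j
        rw [h1]
        show 0 < t.1 j + z j
        omega
      · show 0 < t.2 i
        omega

theorem iter_fix {d : ℕ} (T : Finset (Transition d)) :
    propMap T ((propMap T)^[d] ∅) = (propMap T)^[d] ∅ := by
  have hm : Monotone (fun n => (propMap T)^[n] (∅ : Set (Fin d))) :=
    (prop_mono T).monotone_iterate_of_le_map (Set.empty_subset _)
  have key : ∀ n, propMap T ((propMap T)^[n] ∅) = (propMap T)^[n] ∅ ∨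
      n + 1 ≤ ((propMap T)^[n + 1] (∅ : Set (Fin d))).ncard := by
    intro n
    induction n with
    | zero =>
      by_cases h : propMap T ∅ = ∅
      · left; simpa using h
      · right
        exact (Set.ncard_pos (Set.toFinite _)).2 (Set.nonempty_iff_ne_empty.2 h)
    | succ n ih =>
      rcases ih with h | h
      · left
        rw [Function.iterate_succ_apply', h, h]
      · by_cases h' : propMap T ((propMap T)^[n + 1] ∅) = (propMap T)^[n + 1] ∅
        · exact Or.inl h'
        · right
          have hlt : (propMap T)^[n + 1] (∅ : Set (Fin d)) ⊂ (propMap T)^[n + 1 + 1] ∅ := by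
            refine lt_of_le_of_ne (hm (Nat.le_succ _)) ?_
            rw [Function.iterate_succ_apply' _ (n + 1)]
            exact fun e => h' e.symm
          have := Set.ncard_lt_ncard hlt (Set.toFinite _)
          omega
  rcases key d with h | h
  · exact h
  · have := Set.ncard_le_card ((propMap T)^[d + 1] (∅ : Set (Fin d)))
    rw [Nat.card_fin] at this
    omega

/-- The Kleene iteration of `prop_T` starting from `∅` reaches `I₊(T)` in at most `d` steps. -/
theorem kleene_iteration_reaches_Iplus {d : ℕ} (T : Finset (Transition d)) :
    (propMap T)^[d] (∅ : Set (Fin d)) = Iplus T := by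
  apply Set.Subset.antisymm
  · have : ∀ n, (propMap T)^[n] (∅ : Set (Fin d)) ⊆ Iplus T := by
      intro n
      induction n with
      | zero => exact Set.empty_subset _
      | succ n ih =>
        rw [Function.iterate_succ_apply']
        exact (prop_mono T ih).trans (prop_Iplus T)
    exact this d
  · rintro i ⟨c, ⟨w, hw, hf⟩, hi⟩
    refine fire_pos T _ (iter_fix T).le w 0 c hw hf ?_ hi
    intro j hj
    exact absurd hj (lt_irrefl 0)
end

section
/- For every Petri net T of dimension d there exists a configuration y ∈ ℕ^d such that 0 →T* y and pos(y) = I₊(T). -/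
theorem Fire.add_right {d : ℕ} (z : Config d) (w : List (Transition d)) :
    ∀ x y : Config d, Fire w x y → Fire w (x + z) (y + z) := by
  induction w with
  | nil =>
    intro x y h
    have h' : x = y := h
    subst h'
    exact rfl
  | cons t w ih =>
    rintro x y ⟨c, ⟨a, hx, hc⟩, hw⟩
    refine ⟨c + z, ⟨a + z, ?_, ?_⟩, ih c y hw⟩
    · rw [hx, add_assoc]
    · rw [hc, add_assoc]

theorem Fire.append {d : ℕ} (w w' : List (Transition d)) :
    ∀ x y z : Config d, Fire w x y → Fire w' y z → Fire (w ++ w') x z := by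
  induction w with
  | nil =>
    intro x y z h h2
    have h' : x = y := h
    subst h'
    exact h2
  | cons t w ih =>
    rintro x y z ⟨c, hc, hw⟩ h2
    exact ⟨c, hc, ih c y z hw h2⟩

theorem ReachStar.zero_add {d : ℕ} {T : Finset (Transition d)} {x y : Config d}
    (hx : ReachStar T 0 x) (hy : ReachStar T 0 y) : ReachStar T 0 (x + y) := by
  obtain ⟨w, hw, fw⟩ := hx
  obtain ⟨v, hv, fv⟩ := hy
  refine ⟨v ++ w, ?_, ?_⟩
  · intro t ht
    rcases List.mem_append.1 ht with h | h
    · exact hv t h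
    · exact hw t h
  · refine Fire.append v w 0 y (x + y) fv ?_
    have := Fire.add_right y w 0 x fw
    rwa [_root_.zero_add] at this

theorem exists_reach_superset {d : ℕ} (T : Finset (Transition d)) (s : Finset (Fin d)) :
    ∃ y : Config d, ReachStar T 0 y ∧ ∀ i ∈ s, i ∈ Iplus T → i ∈ pos y := by
  induction s using Finset.induction_on with
  | empty => exact ⟨0, ⟨[], by simp, rfl⟩, by simp⟩
  | insert a s _ ih =>
    obtain ⟨y, hy, hs⟩ := ih
    by_cases ha : a ∈ Iplus T
    · obtain ⟨c, hc, hac⟩ := ha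
      refine ⟨c + y, hc.zero_add hy, ?_⟩
      intro i hi hI
      show 0 < c i + y i
      rcases Finset.mem_insert.1 hi with rfl | h
      · exact Nat.add_pos_left hac _
      · exact Nat.add_pos_right _ (hs i h hI)
    · refine ⟨y, hy, ?_⟩
      intro i hi hI
      rcases Finset.mem_insert.1 hi with rfl | h
      · exact absurd hI ha
      · exact hs i h hI

/-- There exists a configuration `y` with `0 →T* y` and `pos y = I₊(T)`. -/
theorem exists_reachable_with_pos_eq_Iplus {d : ℕ} (T : Finset (Transition d)) :
    ∃ y : Config d, ReachStar T (0 : Config d) y ∧ pos y = Iplus T := by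
  obtain ⟨y, hy, h⟩ := exists_reach_superset T Finset.univ
  refine ⟨y, hy, Set.Subset.antisymm ?_ ?_⟩
  · exact fun i hi => ⟨y, hy, hi⟩
  · exact fun i hi => h i (Finset.mem_univ i) hi
end
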